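/- arXiv:1804.02473 — 2 statements merged into one kernel-verified Lean document; each statement's English description precedes it below -/
import Mathlib

section
/- The grid graph P_m × P_n is neighborhood-prime if exactly one of m or n is odd and the other is congruent to 2 modulo 4. -/
namespace SimpleGraph

open scoped Classical in
/-- A graph of order `n` is *neighborhood-prime* if there is a bijective labeling of the
vertices by `{1, …, n}` such that for every vertex of degree at least 2, the gcd of the
labels appearing in its neighborhood is 1. -/
noncomputable def IsNeighborhoodPrime {V : Type*} [Fintype V] (G : SimpleGraph V) : Prop :=
  ∃ f : V ≃ Fin (Fintype.card V),
    ∀ v : V, 2 ≤ G.degree v →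
      (G.neighborFinset v).gcd (fun u => (f u : ℕ) + 1) = 1

/-- The grid graph `P_m × P_n`: the Cartesian (box) product of the path on `m` vertices
with the path on `n` vertices. -/
def gridGraph (m n : ℕ) : SimpleGraph (Fin m × Fin n) :=
  (SimpleGraph.pathGraph m).boxProd (SimpleGraph.pathGraph n)

/-- Neighborhood-primality is invariant under graph isomorphism. -/
theorem IsNeighborhoodPrime.of_iso {V W : Type*} [Fintype V] [Fintype W] {G : SimpleGraph V}
    {H : SimpleGraph W} (e : G ≃g H) (hG : G.IsNeighborhoodPrime) : H.IsNeighborhoodPrime := by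
  classical
  obtain ⟨f, hf⟩ := hG
  refine ⟨(e.symm.toEquiv.trans f).trans (finCongr (Fintype.card_congr e.toEquiv)), fun w hw => ?_⟩
  have hN : H.neighborFinset w = (G.neighborFinset (e.symm w)).image e := by
    ext u
    simp only [mem_neighborFinset, Finset.mem_image]
    constructor
    · exact fun h => ⟨e.symm u, e.symm.map_adj_iff.2 h, e.apply_symm_apply u⟩
    · rintro ⟨x, hx, rfl⟩
      simpa using e.map_adj_iff.2 hx
  have hdeg : 2 ≤ G.degree (e.symm w) := by
    rw [← card_neighborFinset_eq_degree] at hw ⊢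
    rw [hN, Finset.card_image_of_injective _ e.injective] at hw
    convert hw
  have key := hf _ hdeg
  convert key using 1
  trans ((G.neighborFinset (e.symm w)).image e).gcd
    (fun u => (f (e.symm u) : ℕ) + 1)
  · congr 1
  · rw [Finset.gcd_image]
    congr 1
    funext u
    simp

/-- Two coprime values of `f` on `s` force the gcd of `f` over `s` to be one. -/
theorem _root_.Finset.gcd_eq_one_of_coprime {V : Type*} {s : Finset V} {f : V → ℕ} {a b : V} (ha : a ∈ s)
    (hb : b ∈ s) (h : (f a).Coprime (f b)) : s.gcd f = 1 :=
  Nat.eq_one_of_dvd_coprimes h (Finset.gcd_dvd ha) (Finset.gcd_dvd hb)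

/-- A graph of even order with a Hamiltonian path, given by its position function `p`, is
neighborhood-prime as soon as the initial vertex has degree at most one or is adjacent to the
fourth vertex of the path. -/
theorem isNeighborhoodPrime_of_hamiltonian_path {V : Type*} [Fintype V] (G : SimpleGraph V)
    (k : ℕ) (hk : Fintype.card V = 2 * k) (p : V → ℕ) (hp : Function.Injective p)
    (hlt : ∀ v, p v < 2 * k)
    (hsucc : ∀ v, p v + 1 < 2 * k → ∃ u, G.Adj v u ∧ p u = p v + 1)
    (hstart : ∀ v a b, p v = 0 → G.Adj v a → G.Adj v b → a ≠ b → ∃ u, G.Adj v u ∧ p u = 3) :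
    G.IsNeighborhoodPrime := by
  classical
  have hsurj : ∀ q < 2 * k, ∃ v, p v = q := by
    have hb : Function.Bijective (fun v => (⟨p v, hlt v⟩ : Fin (2 * k))) := by
      rw [Fintype.bijective_iff_injective_and_card]
      exact ⟨fun a b h => hp (by simpa using h), by simpa using hk⟩
    intro q hq
    obtain ⟨v, hv⟩ := hb.2 ⟨q, hq⟩
    exact ⟨v, by simpa using hv⟩
  have hpred : ∀ v, 0 < p v → ∃ u, G.Adj v u ∧ p u + 1 = p v := by
    intro v hv
    obtain ⟨u, hu⟩ := hsurj (p v - 1) (by have := hlt v; omega)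
    obtain ⟨w, hw, hw'⟩ := hsucc u (by have := hlt v; omega)
    obtain rfl : w = v := hp (by omega)
    exact ⟨u, hw.symm, by omega⟩
  let g : V → ℕ := fun v => if p v % 2 = 1 then k + p v / 2 else k - 1 - p v / 2
  have hg : ∀ v, g v < Fintype.card V := by
    intro v
    have := hlt v
    simp only [g]
    split_ifs <;> omega
  have hbij : Function.Bijective (fun v => (⟨g v, hg v⟩ : Fin (Fintype.card V))) := by
    rw [Fintype.bijective_iff_injective_and_card]
    refine ⟨fun a b h => hp ?_, by simp⟩
    have h' : g a = g b := by simpa using h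
    have := hlt a
    have := hlt b
    simp only [g] at h'
    split_ifs at h' <;> omega
  refine ⟨Equiv.ofBijective _ hbij, fun v hv => ?_⟩
  have := hlt v
  have hcop : ∀ a b, G.Adj v a → G.Adj v b → g b = g a + 1 → (G.neighborFinset v).gcd
      (fun u => (Equiv.ofBijective _ hbij u : ℕ) + 1) = 1 := by
    intro a b ha hb hab
    refine Finset.gcd_eq_one_of_coprime (a := a) (b := b) (by simpa using ha) (by simpa using hb) ?_
    simp [hab]
  by_cases h0 : p v = 0
  · obtain ⟨a, b, ha, hb, hab⟩ : ∃ a b, G.Adj v a ∧ G.Adj v b ∧ a ≠ b := by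
      rw [← card_neighborFinset_eq_degree] at hv
      obtain ⟨a, ha, b, hb, hab⟩ := Finset.one_lt_card.1 hv
      exact ⟨a, b, by simpa using ha, by simpa using hb, hab⟩
    obtain ⟨u, hu, hu3⟩ := hstart v a b h0 ha hb hab
    obtain ⟨w, hw, hw1⟩ := hsucc v (by have := hlt u; omega)
    exact hcop w u hw hu (by simp only [g]; split_ifs <;> omega)
  · obtain ⟨u, hu, hu'⟩ := hpred v (by omega)
    by_cases hl : p v + 1 < 2 * k
    · obtain ⟨w, hw, hw'⟩ := hsucc v hl
      by_cases hpar : p v % 2 = 0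
      · exact hcop u w hu hw (by simp only [g]; split_ifs <;> omega)
      · exact hcop w u hw hu (by simp only [g]; split_ifs <;> omega)
    · refine Finset.gcd_eq_one_of_coprime (a := u) (b := u) (by simpa using hu) (by simpa using hu) ?_
      have : g u = 0 := by simp only [g]; split_ifs <;> omega
      simp [this]

/-- Position of the cell in row `i` and column `j` along a Hamiltonian path of a grid with `m`
columns: the first two rows are traversed column by column, the others row by row. -/
def gridPosition (m i j : ℕ) : ℕ :=
  if i < 2 then (if j % 2 = 0 then 2 * j + i else 2 * j + 1 - i)
  else if i % 2 = 0 then i * m + (m - 1 - j) else i * m + j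

theorem gridPosition_lt {m i j : ℕ} (hi : i < 2) (hj : j < m) : gridPosition m i j < 2 * m := by
  unfold gridPosition
  split_ifs <;> omega

theorem gridPosition_div {m i j : ℕ} (hi : 2 ≤ i) (hj : j < m) : gridPosition m i j / m = i := by
  rw [Nat.div_eq_iff (by omega)]
  unfold gridPosition
  split_ifs <;> constructor <;> omega

theorem gridPosition_inj {m i j i' j' : ℕ} (hj : j < m) (hj' : j' < m)
    (h : gridPosition m i j = gridPosition m i' j') : i = i' ∧ j = j' := by
  have small : ∀ a b, a < 2 → b < m → gridPosition m a b / m < 2 := fun a b ha hb =>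
    Nat.div_lt_of_lt_mul (by have := gridPosition_lt ha hb; omega)
  by_cases hi : i < 2 <;> by_cases hi' : i' < 2
  · unfold gridPosition at h
    split_ifs at h <;> omega
  · have h1 := small i j hi hj
    rw [h, gridPosition_div (by omega) hj'] at h1
    omega
  · have h1 := small i' j' hi' hj'
    rw [← h, gridPosition_div (by omega) hj] at h1
    omega
  · have h1 := gridPosition_div (i := i) (by omega) hj
    rw [h, gridPosition_div (by omega) hj'] at h1
    subst h1
    unfold gridPosition at h
    split_ifs at h <;> omega

theorem gridPosition_lt_mul {m n i j : ℕ} (hn : 2 ≤ n) (hi : i < n) (hj : j < m) :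
    gridPosition m i j < n * m := by
  by_cases h2 : i < 2
  · exact (gridPosition_lt h2 hj).trans_le (Nat.mul_le_mul_right m hn)
  · rw [← Nat.div_lt_iff_lt_mul (by omega), gridPosition_div (by omega) hj]
    exact hi

theorem gridGraph_adj {m n : ℕ} (x y : Fin m × Fin n) : (gridGraph m n).Adj x y ↔
    ((x.1 : ℕ) + 1 = y.1 ∨ (y.1 : ℕ) + 1 = x.1) ∧ (x.2 : ℕ) = y.2 ∨
      ((x.2 : ℕ) + 1 = y.2 ∨ (y.2 : ℕ) + 1 = x.2) ∧ (x.1 : ℕ) = y.1 := by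
  simp [gridGraph, boxProd_adj, pathGraph_adj, Fin.ext_iff]

theorem gridPosition_succ {m n i j : ℕ} (hm : Odd m) (hn : 2 ≤ n) (hi : i < n) (hj : j < m)
    (h : gridPosition m i j + 1 < n * m) : ∃ i' j', i' < n ∧ j' < m ∧
      ((i + 1 = i' ∨ i' + 1 = i) ∧ j = j' ∨ (j + 1 = j' ∨ j' + 1 = j) ∧ i = i') ∧
      gridPosition m i' j' = gridPosition m i j + 1 := by
  have hm' := Nat.odd_iff.1 hm
  have hsm : (i + 1) * m = i * m + m := Nat.succ_mul i m
  have hlast : i * m + m < n * m → i + 1 < n := fun h' =>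
    lt_of_mul_lt_mul_right (hsm ▸ h') (Nat.zero_le m)
  by_cases h2 : i < 2
  · obtain rfl | rfl : i = 0 ∨ i = 1 := by omega
    · by_cases hpar : j % 2 = 0
      · exact ⟨1, j, by omega, hj, by omega, by simp [gridPosition, hpar]⟩
      · refine ⟨0, j + 1, hi, by omega, by omega, ?_⟩
        unfold gridPosition
        split_ifs <;> omega
    · by_cases hpar : j % 2 = 0
      · by_cases hjm : j + 1 < m
        · refine ⟨1, j + 1, hi, hjm, by omega, ?_⟩
          unfold gridPosition
          split_ifs <;> omega
        · have : gridPosition m 1 j + 1 = 1 * m + m := by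
            unfold gridPosition
            split_ifs
            omega
          refine ⟨2, j, hlast (by omega), hj, by omega, ?_⟩
          rw [this]
          simp [gridPosition]
          omega
      · refine ⟨0, j, by omega, hj, by omega, ?_⟩
        unfold gridPosition
        split_ifs <;> omega
  · by_cases hpar : i % 2 = 0
    · have hp : gridPosition m i j = i * m + (m - 1 - j) := by simp [gridPosition, h2, hpar]
      by_cases hj0 : j = 0
      · refine ⟨i + 1, j, hlast (by omega), hj, by omega, ?_⟩
        rw [hp]
        unfold gridPosition
        split_ifs <;> omega
      · refine ⟨i, j - 1, hi, by omega, by omega, ?_⟩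
        unfold gridPosition
        split_ifs
        omega
    · have hp : gridPosition m i j = i * m + j := by simp [gridPosition, h2, hpar]
      by_cases hjm : j + 1 < m
      · refine ⟨i, j + 1, hi, hjm, by omega, ?_⟩
        unfold gridPosition
        split_ifs
        omega
      · refine ⟨i + 1, j, hlast (by omega), hj, by omega, ?_⟩
        rw [hp]
        unfold gridPosition
        split_ifs <;> omega

theorem gridGraph_isNeighborhoodPrime_of_even_of_odd {m n : ℕ} (hn0 : 0 < n) (hn : Even n)
    (hm : Odd m) : (gridGraph n m).IsNeighborhoodPrime := by
  obtain ⟨k, rfl⟩ := hn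
  have hk : (k + k) * m = 2 * (k * m) := by ring
  refine isNeighborhoodPrime_of_hamiltonian_path _ (k * m) (by simp [← hk])
    (fun x => gridPosition m x.1 x.2) ?_ ?_ ?_ ?_
  · rintro ⟨i, j⟩ ⟨i', j'⟩ h
    obtain ⟨h1, h2⟩ := gridPosition_inj j.2 j'.2 h
    exact Prod.ext (Fin.ext h1) (Fin.ext h2)
  · rintro ⟨i, j⟩
    rw [← hk]
    exact gridPosition_lt_mul (by omega) i.2 j.2
  · rintro ⟨i, j⟩ h
    rw [← hk] at h
    obtain ⟨i', j', hi', hj', hadj, hp⟩ := gridPosition_succ hm (by omega) i.2 j.2 h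
    exact ⟨(⟨i', hi'⟩, ⟨j', hj'⟩), (gridGraph_adj _ _).2 hadj, hp⟩
  · rintro ⟨i, j⟩ ⟨a, a'⟩ ⟨b, b'⟩ h0 ha hb hab
    have h00 : gridPosition m i j = gridPosition m 0 0 := by rw [h0]; simp [gridPosition]
    obtain ⟨hi, hj⟩ := gridPosition_inj j.2 hm.pos h00
    rw [gridGraph_adj] at ha hb
    simp only [ne_eq, Prod.mk.injEq, Fin.ext_iff] at ha hb hab
    have h1 : 1 < m := by omega
    refine ⟨(⟨0, hn0⟩, ⟨1, h1⟩), (gridGraph_adj _ _).2 ?_, by simp [gridPosition]⟩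
    simp [hi, hj]

end SimpleGraph

/-- The grid graph P_m × P_n is neighborhood-prime if exactly one of m or n is
odd and the other is congruent to 2 modulo 4. -/
theorem gridGraph_odd_two_mod_four_isNeighborhoodPrime (m n : ℕ) (hm : 1 ≤ m) (hn : 1 ≤ n)
    (h : (Odd m ∧ ¬ Odd n ∧ n % 4 = 2) ∨ (Odd n ∧ ¬ Odd m ∧ m % 4 = 2)) :
    (SimpleGraph.gridGraph m n).IsNeighborhoodPrime := by
  rcases h with ⟨hodd, hn', -⟩ | ⟨hodd, hm', -⟩
  · exact (SimpleGraph.gridGraph_isNeighborhoodPrime_of_even_of_odd hn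
      (Nat.not_odd_iff_even.1 hn') hodd).of_iso (SimpleGraph.boxProdComm _ _)
  · exact SimpleGraph.gridGraph_isNeighborhoodPrime_of_even_of_odd hm
      (Nat.not_odd_iff_even.1 hm') hodd
end

section
/- The three-dimensional grid graph P_ℓ × P_m × P_n is neighborhood-prime whenever the product ℓ·m·n is congruent to 0 modulo 4. -/
namespace SimpleGraph

/-- A finite graph is *traceable* if its vertices can be numbered along a Hamiltonian path. -/
def IsTraceable {V : Type*} [Fintype V] (G : SimpleGraph V) : Prop :=
  ∃ e : V ≃ Fin (Fintype.card V), ∀ u v, (e u : ℕ) + 1 = e v → G.Adj u v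

theorem isTraceable_of_equiv {V : Type*} [Fintype V] {G : SimpleGraph V} {N : ℕ}
    (e : V ≃ Fin N) (he : ∀ u v, (e u : ℕ) + 1 = e v → G.Adj u v) : G.IsTraceable :=
  ⟨e.trans (finCongr (by simpa using (Fintype.card_congr e).symm)), by simpa using he⟩

theorem pathGraph_isTraceable (n : ℕ) : (pathGraph n).IsTraceable :=
  isTraceable_of_equiv (Equiv.refl _) fun _ _ h => pathGraph_adj.2 (Or.inl h)

/-- Traverse consecutive copies of `G` alternately forwards and backwards. -/
theorem IsTraceable.pathGraph_boxProd {V : Type*} [Fintype V] {G : SimpleGraph V}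
    (hG : G.IsTraceable) (l : ℕ) : ((pathGraph l).boxProd G).IsTraceable := by
  obtain ⟨e, he⟩ := hG
  refine isTraceable_of_equiv ((Equiv.prodCongrRight fun i : Fin l =>
    if (i : ℕ) % 2 = 0 then e else e.trans Fin.revPerm).trans finProdFinEquiv) ?_
  rintro ⟨i, u⟩ ⟨j, v⟩ h
  simp only [Equiv.trans_apply, Equiv.prodCongrRight_apply, finProdFinEquiv_apply_val] at h
  rw [boxProd_adj, pathGraph_adj]
  set a := (if (i : ℕ) % 2 = 0 then e else e.trans Fin.revPerm) u with ha
  set b := (if (j : ℕ) % 2 = 0 then e else e.trans Fin.revPerm) v with hb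
  have ha' := a.isLt
  have hb' := b.isLt
  have hu := (e u).isLt
  have hv := (e v).isLt
  have hij : (i : ℕ) = j ∨ (i : ℕ) + 1 = j := by
    have h₁ : (i : ℕ) < j + 1 := by
      by_contra! hlt
      nlinarith
    have h₂ : (j : ℕ) < i + 2 := by
      by_contra! hlt
      nlinarith
    lia
  rcases hij with hij | hij
  · obtain rfl := Fin.ext hij
    refine Or.inr ⟨?_, rfl⟩
    have hab : (a : ℕ) + 1 = b := by lia
    split_ifs at ha hb with hi
    · exact he _ _ (by rw [← ha, ← hb, hab])
    · refine (he _ _ ?_).symm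
      have ha := congrArg Fin.val ha
      have hb := congrArg Fin.val hb
      simp only [Equiv.trans_apply, Fin.revPerm_apply, Fin.val_rev] at ha hb
      lia
  · refine Or.inl ⟨Or.inl hij, e.injective (Fin.ext ?_)⟩
    have hab : (a : ℕ) + 1 = b + Fintype.card V := by
      rw [← hij] at h
      linarith
    have ha := congrArg Fin.val ha
    have hb := congrArg Fin.val hb
    split_ifs at ha hb <;> first
      | lia
      | simp only [Equiv.trans_apply, Fin.revPerm_apply, Fin.val_rev] at ha hb
        lia

/-- The labels along a path on `2 * k` vertices: the odd positions receive `0, …, k - 1` in order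
and the even positions receive a rotation by `s` of `k, …, 2 * k - 1`. -/
def alternatingLabel (k s i : ℕ) : ℕ :=
  if i % 2 = 1 then i / 2 else k + (i / 2 + s) % k

theorem alternatingLabel_lt {k s i : ℕ} (hi : i < 2 * k) : alternatingLabel k s i < 2 * k := by
  have := Nat.mod_lt (i / 2 + s) (show 0 < k by lia)
  unfold alternatingLabel
  split_ifs <;> lia

theorem alternatingLabel_injOn (k s : ℕ) :
    Set.InjOn (alternatingLabel k s) (Set.Iio (2 * k)) := by
  intro i hi j hj h
  simp only [Set.mem_Iio] at hi hj
  unfold alternatingLabel at h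
  split_ifs at h with h₁ h₂ h₂
  · lia
  · lia
  · lia
  · have hmod : i / 2 ≡ j / 2 [MOD k] := Nat.ModEq.add_right_cancel' s (by
      unfold Nat.ModEq
      lia)
    have := hmod.eq_of_lt_of_lt (by lia) (by lia)
    lia

theorem coprime_alternatingLabel {k s i : ℕ} (hk : Even k) (hi : i + 2 < 2 * k) :
    Nat.Coprime (alternatingLabel k s i + 1) (alternatingLabel k s (i + 2) + 1) := by
  have hsucc (a : ℕ) : Nat.Coprime a (a + 1) := by simp
  unfold alternatingLabel
  have hdiv : (i + 2) / 2 = i / 2 + 1 := by lia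
  rw [Nat.add_mod_right, hdiv]
  split_ifs with h
  · exact hsucc _
  · have hlt := Nat.mod_lt (i / 2 + s) (show 0 < k by lia)
    rw [show i / 2 + 1 + s = i / 2 + s + 1 by ring, Nat.add_mod (i / 2 + s) 1 k,
      Nat.mod_eq_of_lt (show 1 < k by lia)]
    rcases Nat.lt_or_ge ((i / 2 + s) % k + 1) k with hlt' | hge
    · rw [Nat.mod_eq_of_lt hlt']
      exact hsucc _
    · have hlast : (i / 2 + s) % k + 1 = k := by lia
      rw [hlast, Nat.mod_self, add_assoc, hlast, add_zero]
      have hodd : Nat.Coprime 2 (k + 1) := Nat.coprime_two_left.2 hk.add_one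
      rw [← two_mul]
      exact hodd.mul_left (hsucc k)

/-- The rotation is by a prime `p` with `k < p ≤ 2 * k`, so that the penultimate vertex of the
path receives the label `p`, which is coprime to every other label. -/
theorem IsTraceable.isNeighborhoodPrime {V : Type*} [Fintype V] [Nonempty V]
    {G : SimpleGraph V} (hG : G.IsTraceable) (hcard : Fintype.card V % 4 = 0) :
    G.IsNeighborhoodPrime := by
  obtain ⟨e, he⟩ := hG
  obtain ⟨k, hk⟩ : ∃ k, Fintype.card V = 2 * k := ⟨Fintype.card V / 2, by lia⟩
  have hpos := Fintype.card_pos (α := V)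
  have hkeven : Even k := Nat.even_iff.2 (by lia)
  obtain ⟨p, hp, hkp, hpk⟩ := Nat.exists_prime_lt_and_le_two_mul k (by lia)
  have hlt (i : Fin (Fintype.card V)) : alternatingLabel k p i < Fintype.card V :=
    (alternatingLabel_lt (i.isLt.trans_eq hk)).trans_eq hk.symm
  have hinj : Function.Injective fun i : Fin (Fintype.card V) =>
      (⟨alternatingLabel k p i, hlt i⟩ : Fin (Fintype.card V)) := fun i j h =>
    Fin.ext (alternatingLabel_injOn k p (by simpa [hk] using i.isLt) (by simpa [hk] using j.isLt)
      (congrArg Fin.val h))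
  let f := e.trans (Equiv.ofBijective _ (Finite.injective_iff_bijective.1 hinj))
  have hf (v : V) : (f v : ℕ) = alternatingLabel k p (e v) := rfl
  have hvertex (i : ℕ) (hi : i < Fintype.card V) : ∃ v, (e v : ℕ) = i :=
    ⟨e.symm ⟨i, hi⟩, by simp⟩
  refine ⟨f, fun v hv => ?_⟩
  suffices h : ∃ u w, G.Adj v u ∧ G.Adj v w ∧ Nat.Coprime (f u + 1) (f w + 1) by
    obtain ⟨u, w, hu, hw, huw⟩ := h
    exact Nat.eq_one_of_dvd_coprimes huw
      (Finset.gcd_dvd (by simpa using hu)) (Finset.gcd_dvd (by simpa using hw))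
  have hvlt := (e v).isLt
  rcases Nat.eq_zero_or_pos (e v) with h₀ | h₀
  · obtain ⟨u, hu⟩ := hvertex 1 (by lia)
    have hvu := he v u (by lia)
    exact ⟨u, u, hvu, hvu, by simp [hf, hu, alternatingLabel]⟩
  obtain ⟨u, hu⟩ := hvertex (e v - 1) (by lia)
  have huv := he u v (by lia)
  rcases Nat.lt_or_ge ((e v : ℕ) + 1) (Fintype.card V) with h₁ | h₁
  · obtain ⟨w, hw⟩ := hvertex (e v + 1) h₁
    refine ⟨u, w, huv.symm, he v w hw.symm, ?_⟩
    rw [hf, hf, hw, show (e v : ℕ) + 1 = e u + 2 by lia]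
    exact coprime_alternatingLabel hkeven (by lia)
  · obtain ⟨w, hw, hwu⟩ := Finset.exists_mem_ne hv u
    refine ⟨u, w, huv.symm, by simpa using hw, ?_⟩
    have hfu : (f u : ℕ) + 1 = p := by
      rw [hf, hu]
      unfold alternatingLabel
      rw [if_neg (by lia), show ((e v : ℕ) - 1) / 2 + p = (p - k - 1) + k + k by lia,
        Nat.add_mod_right, Nat.add_mod_right, Nat.mod_eq_of_lt (by lia)]
      lia
    have hfw : (f w : ℕ) ≠ f u := fun h => hwu (f.injective (Fin.ext h))
    have hwlt := (f w).isLt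
    rw [hfu, hp.coprime_iff_not_dvd]
    rintro ⟨c, hc⟩
    have hc₂ : c < 2 := by
      by_contra! hge
      nlinarith
    interval_cases c <;> lia

end SimpleGraph

/-- The three-dimensional grid graph P_ℓ × P_m × P_n is neighborhood-prime
whenever the product ℓ·m·n is congruent to 0 modulo 4. -/
theorem gridGraph3_isNeighborhoodPrime (l m n : ℕ) (hl : 1 ≤ l) (hm : 1 ≤ m) (hn : 1 ≤ n)
    (h : l * m * n % 4 = 0) :
    ((SimpleGraph.pathGraph l).boxProd
      ((SimpleGraph.pathGraph m).boxProd (SimpleGraph.pathGraph n))).IsNeighborhoodPrime := by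
  have : Nonempty (Fin l × Fin m × Fin n) := ⟨⟨0, hl⟩, ⟨0, hm⟩, ⟨0, hn⟩⟩
  refine SimpleGraph.IsTraceable.isNeighborhoodPrime
    (((SimpleGraph.pathGraph_isTraceable n).pathGraph_boxProd m).pathGraph_boxProd l) ?_
  simpa [mul_assoc] using h
end
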